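/- Let v_1, …, v_d be LDP fan data with d ≥ 5 and exactly three singular cones. Then there is a chain of LDP fan data of lengths d, d−1, …, 5, each with exactly three singular cones, starting from the given data, in which each data of length m (6 ≤ m ≤ d) contains an index k with v_k = v_{k−1} + v_{k+1} and det(v_{k−1}, v_k) = det(v_k, v_{k+1}) = 1, and the data of length m−1 is obtained by deleting v_k. (Equivalently, X(Δ) is obtained from a toric log del Pezzo surface of Picard number three by a sequence of blow-ups at nonsingular torus-fixed points, all intermediate surfaces being log del Pezzo.) -/

import Mathlib

/-- The determinant `det(u, w) = u₁w₂ − u₂w₁` of two integer vectors. -/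
def detZ (u w : ℤ × ℤ) : ℤ := u.1 * w.2 - u.2 * w.1

/-- The real vector associated to an integer vector. -/
noncomputable def toR2 (u : ℤ × ℤ) : ℝ × ℝ := ((u.1 : ℝ), (u.2 : ℝ))

/-- The cone `ℝ_{≥0} u + ℝ_{≥0} w` spanned by two integer vectors. -/
def coneOf (u w : ℤ × ℤ) : Set (ℝ × ℝ) :=
  {x | ∃ a b : ℝ, 0 ≤ a ∧ 0 ≤ b ∧ x = a • toR2 u + b • toR2 w}

/-- Complete fan data of length `d`: a cyclic sequence of primitive integer vectors with
`det(v_i, v_{i+1}) ≥ 1` whose successive cones cover `ℝ²` and have pairwise disjoint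
interiors. -/
def IsCompleteFanData (d : ℕ) (v : ZMod d → ℤ × ℤ) : Prop :=
  3 ≤ d ∧
  (∀ i, Int.gcd (v i).1 (v i).2 = 1) ∧
  (∀ i, 1 ≤ detZ (v i) (v (i + 1))) ∧
  (⋃ i, coneOf (v i) (v (i + 1))) = Set.univ ∧
  ∀ i j, i ≠ j →
    interior (coneOf (v i) (v (i + 1))) ∩ interior (coneOf (v j) (v (j + 1))) = ∅

/-- `f(i) = det(v_{i−1}, v_i) + det(v_i, v_{i+1}) + det(v_{i+1}, v_{i−1})`. -/
def fanF (d : ℕ) (v : ZMod d → ℤ × ℤ) (i : ZMod d) : ℤ :=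
  detZ (v (i - 1)) (v i) + detZ (v i) (v (i + 1)) + detZ (v (i + 1)) (v (i - 1))

/-- LDP fan data: complete fan data with `f(i) ≥ 1` for all `i`. -/
def IsLDPFanData (d : ℕ) (v : ZMod d → ℤ × ℤ) : Prop :=
  IsCompleteFanData d v ∧ ∀ i, 1 ≤ fanF d v i

/-- The number of singular cones, i.e. indices `i` with `det(v_i, v_{i+1}) ≥ 2`. -/
noncomputable def numSingular (d : ℕ) (v : ZMod d → ℤ × ℤ) : ℕ :=
  {i : ZMod d | 2 ≤ detZ (v i) (v (i + 1))}.ncard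

/-- Equivalence of fan data: some `GL(2, ℤ)` matrix maps the vector set of one
bijectively onto the vector set of the other. -/
def FanEquiv {d₁ d₂ : ℕ} (v : ZMod d₁ → ℤ × ℤ) (w : ZMod d₂ → ℤ × ℤ) : Prop :=
  ∃ M : Matrix (Fin 2) (Fin 2) ℤ, IsUnit M.det ∧
    (fun u : ℤ × ℤ => (M 0 0 * u.1 + M 0 1 * u.2, M 1 0 * u.1 + M 1 1 * u.2)) ''
      Set.range v = Set.range w

/-- The cyclic sequence of length `d − 1` obtained by deleting the vector `v_k`:
it lists `v_{k+1}, v_{k+2}, …, v_{k+d−1}`. -/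
def deleteAt {d : ℕ} (v : ZMod d → ℤ × ℤ) (k : ZMod d) : ZMod (d - 1) → ℤ × ℤ :=
  fun i => v (k + 1 + (i.val : ZMod d))

/-- The cyclic sequence of length `d + 1` obtained by inserting `v_k + v_{k+1}`
between `v_k` and `v_{k+1}`. -/
def insertAt {d : ℕ} (v : ZMod d → ℤ × ℤ) (k : ZMod d) : ZMod (d + 1) → ℤ × ℤ :=
  fun i =>
    if i.val ≤ k.val then v ((i.val : ℕ) : ZMod d)
    else if i.val = k.val + 1 then v k + v (k + 1)
    else v ((i.val - 1 : ℕ) : ZMod d)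


/-! ### Scalar lemmas -/

/-- Three consecutive nonsingular cones leave room for at most one further ray. -/
lemma scal_run3 (a b x y x' y' : ℤ) (ha : a ≤ 0) (hb : b ≤ 0)
    (h1 : x ≤ (1 - a) * y) (h2 : x + y ≤ 0) (h3 : y ≤ (1 - b) * x)
    (h1' : x' ≤ (1 - a) * y') (h2' : x' + y' ≤ 0) (h3' : y' ≤ (1 - b) * x')
    (hdet : 1 ≤ x * y' - y * x') : False := by
  have key : ∀ x y : ℤ, x ≤ (1 - a) * y → x + y ≤ 0 → y ≤ (1 - b) * x → x = y := by
    intro x y h1 h2 h3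
    have hx : x ≤ 0 := by
      by_contra hx
      have : y < 0 := by omega
      nlinarith
    have hy : y ≤ 0 := by
      by_contra hy
      have : x < 0 := by omega
      nlinarith
    nlinarith
  have e := key x y h1 h2 h3
  have e' := key x' y' h1' h2' h3'
  subst e e'
  nlinarith

/-- Two adjacent nonsingular cones spanning at least a half plane, and another one. -/
lemma scal_pair (a x y x' y' : ℤ) (ha : a ≤ 0)
    (h1 : x ≤ (1 - a) * y) (h2 : x + y ≤ 0)
    (hdet : x * y' - y * x' = 1) (h5 : x ≤ x')
    (h6 : -x - a * y ≤ -x' - a * y')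
    (h7 : 2 ≤ -x ∨ 2 ≤ -x' - a * y') : False := by
  obtain ⟨p, rfl⟩ : ∃ p, x' = x + p := ⟨x' - x, by ring⟩
  obtain ⟨q, rfl⟩ : ∃ q, y' = y + q := ⟨y' - y, by ring⟩
  have hd : x * q - y * p = 1 := by linarith
  have hp : 0 ≤ p := by linarith
  have hpq : p ≤ -a * q := by linarith
  have hx : x ≤ 0 := by
    by_contra hx
    have : y < 0 := by omega
    nlinarith
  rcases hp.eq_or_lt with rfl | hp
  · have hxq : x * q = 1 := by linarith
    have hx1 : x = -1 := by
      rcases Int.eq_one_or_neg_one_of_mul_eq_one hxq with h | h <;> omega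
    subst hx1
    have hq : q = -1 := by omega
    subst hq
    have : a = 0 := by omega
    subst this
    rcases h7 with h7 | h7 <;> omega
  · have hq : 0 < q := by
      by_contra hq
      have : 0 ≤ (-a) * (-q) := mul_nonneg (by omega) (by omega)
      nlinarith
    have e1 : x * p ≤ (1 - a) * y * p := by nlinarith
    have e2 : x * (-a * q) ≤ x * p := by nlinarith
    have e3 : (1 - a) * (y * p) = (1 - a) * (x * q - 1) := by rw [← hd]; ring
    nlinarith [mul_nonneg (neg_nonneg.2 hx) hq.le]

/-- Two nonsingular cones separated by a singular one. -/
lemma scal_sep (x y p q : ℤ) (h1 : x + y ≤ 0) (h2 : x ≤ -2) (hd : x * q - y * p = 1)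
    (hp : 0 ≤ p) : 0 ≤ p + q := by
  by_contra h
  have hq : q + 1 ≤ -p := by omega
  nlinarith [mul_nonneg hp (neg_nonneg.2 h1)]

lemma scal_three (x y p q r s : ℤ) (hp : 0 ≤ p) (hq : q ≤ 0) (hpq : 0 ≤ p + q)
    (hr : 0 ≤ r) (hs : s ≤ 0) (hrs : r + s ≤ 0) (hx : x ≤ -2)
    (h1 : x * q - y * p = 1) (h2 : x * s - y * r ≤ 0) (hne : r ≠ 0 ∨ s ≠ 0) : False := by
  have hs' : s < 0 := by omega
  have hxs : 0 < x * s := by nlinarith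
  have hr' : 0 < r := by
    rcases hr.eq_or_lt with rfl | h
    · linarith
    · exact h
  have hy : -x ≤ y := by
    by_contra hy
    have : y * r < -x * r := by nlinarith
    nlinarith
  nlinarith

/-! ### Interiors of cones -/

/-- The real determinant. -/
def detR (x y : ℝ × ℝ) : ℝ := x.1 * y.2 - x.2 * y.1

lemma detR_toR2 (u w : ℤ × ℤ) : detR (toR2 u) (toR2 w) = (detZ u w : ℝ) := by
  simp [detR, toR2, detZ]

lemma mem_coneOf_iff (u w : ℤ × ℤ) (h : 1 ≤ detZ u w) (x : ℝ × ℝ) :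
    x ∈ coneOf u w ↔ 0 ≤ detR (toR2 u) x ∧ 0 ≤ detR x (toR2 w) := by
  have hD : (0 : ℝ) < detR (toR2 u) (toR2 w) := by
    rw [detR_toR2]; exact_mod_cast h
  constructor
  · rintro ⟨a, b, ha, hb, rfl⟩
    constructor
    · have : detR (toR2 u) (a • toR2 u + b • toR2 w) = b * detR (toR2 u) (toR2 w) := by
        simp [detR]; ring
      rw [this]; positivity
    · have : detR (a • toR2 u + b • toR2 w) (toR2 w) = a * detR (toR2 u) (toR2 w) := by
        simp [detR]; ring
      rw [this]; positivity
  · rintro ⟨h1, h2⟩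
    refine ⟨detR x (toR2 w) / detR (toR2 u) (toR2 w), detR (toR2 u) x / detR (toR2 u) (toR2 w),
      by positivity, by positivity, ?_⟩
    have hD' := hD.ne'
    ext
    · simp only [Prod.fst_add, Prod.smul_fst, smul_eq_mul]
      field_simp
      simp [detR]; ring
    · simp only [Prod.snd_add, Prod.smul_snd, smul_eq_mul]
      field_simp
      simp [detR]; ring

lemma exists_small (U : Set (ℝ × ℝ)) (hU : IsOpen U) (x z : ℝ × ℝ) (hx : x ∈ U) :
    ∃ e : ℝ, 0 < e ∧ x + e • z ∈ U := by
  have hc : ContinuousAt (fun e : ℝ => x + e • z) 0 := by fun_prop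
  have h1 : ∀ᶠ e in nhds (0 : ℝ), x + e • z ∈ U :=
    hc.eventually (hU.mem_nhds (by simpa using hx))
  have h2 : ∀ᶠ e in nhdsWithin (0 : ℝ) (Set.Ioi 0), x + e • z ∈ U :=
    h1.filter_mono nhdsWithin_le_nhds
  obtain ⟨e, he, he'⟩ := (h2.and self_mem_nhdsWithin).exists
  exact ⟨e, he', he⟩

lemma mem_interior_coneOf_iff (u w : ℤ × ℤ) (h : 1 ≤ detZ u w) (x : ℝ × ℝ) :
    x ∈ interior (coneOf u w) ↔ 0 < detR (toR2 u) x ∧ 0 < detR x (toR2 w) := by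
  have hD : (0 : ℝ) < detR (toR2 u) (toR2 w) := by
    rw [detR_toR2]; exact_mod_cast h
  constructor
  · intro hx
    obtain ⟨e, he, hm⟩ := exists_small _ isOpen_interior x (-(toR2 u + toR2 w)) hx
    have hm := (mem_coneOf_iff u w h _).1 (interior_subset hm)
    have e1 : detR (toR2 u) (x + e • -(toR2 u + toR2 w))
        = detR (toR2 u) x - e * detR (toR2 u) (toR2 w) := by
      simp [detR]; ring
    have e2 : detR (x + e • -(toR2 u + toR2 w)) (toR2 w)
        = detR x (toR2 w) - e * detR (toR2 u) (toR2 w) := by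
      simp [detR]; ring
    rw [e1, e2] at hm
    have := mul_pos he hD
    exact ⟨by linarith [hm.1], by linarith [hm.2]⟩
  · rintro ⟨h1, h2⟩
    have c1 : Continuous fun x : ℝ × ℝ => detR (toR2 u) x := by unfold detR; fun_prop
    have c2 : Continuous fun x : ℝ × ℝ => detR x (toR2 w) := by unfold detR; fun_prop
    have ho : IsOpen {x : ℝ × ℝ | 0 < detR (toR2 u) x ∧ 0 < detR x (toR2 w)} :=
      (isOpen_lt continuous_const c1).inter (isOpen_lt continuous_const c2)
    refine interior_maximal ?_ ho ⟨h1, h2⟩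
    rintro y ⟨h1, h2⟩
    exact (mem_coneOf_iff u w h y).2 ⟨h1.le, h2.le⟩

/-! ### Global convexity -/

lemma natCast_ne_zero_of_lt {d n : ℕ} (h0 : 0 < n) (h1 : n < d) : (n : ZMod d) ≠ 0 := by
  rw [Ne, ZMod.natCast_eq_zero_iff]
  exact fun h => absurd (Nat.le_of_dvd h0 h) (by omega)

lemma detZ_anti (u w : ℤ × ℤ) : detZ u w = - detZ w u := by
  unfold detZ; ring

lemma fan_step {d : ℕ} {v : ZMod d → ℤ × ℤ} (h : IsCompleteFanData d v) (j : ZMod d) (s : ℕ)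
    (hs1 : 1 ≤ s) (hs : s + 1 < d) (hneg : detZ (v j) (v (j + s)) ≤ 0) :
    detZ (v j) (v (j + (s + 1 : ℕ))) ≤ 0 := by
  by_contra hpos
  push Not at hpos
  obtain ⟨-, -, hdet, -, hdis⟩ := h
  have hne : j ≠ j + (s : ZMod d) := by
    intro e
    exact natCast_ne_zero_of_lt (d := d) (n := s) (by omega) (by omega) (left_eq_add.1 e)
  have hD := hdis j (j + s) hne
  have d0 := hdet j
  have d1 := hdet (j + s)
  have hcast : j + ((s + 1 : ℕ) : ZMod d) = j + s + 1 := by push_cast; ring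
  rw [hcast] at hpos
  set u0 := v j
  set u1 := v (j + 1)
  set us := v (j + s)
  set ut := v (j + s + 1)
  set N : ℤ := 1 + |detZ us u1| + |detZ u1 ut| with hN
  have hN1 : 1 ≤ N := by have := abs_nonneg (detZ us u1); have := abs_nonneg (detZ u1 ut); omega
  have hNa : 1 - detZ us u1 ≤ N := by
    have := neg_abs_le (detZ us u1); have := abs_nonneg (detZ u1 ut); omega
  have hNb : 1 - detZ u1 ut ≤ N := by
    have := neg_abs_le (detZ u1 ut); have := abs_nonneg (detZ us u1); omega
  set p : ℤ × ℤ := (N * u0.1 + u1.1, N * u0.2 + u1.2) with hp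
  have q1 : detZ u0 p = detZ u0 u1 := by simp only [hp, detZ]; ring
  have q2 : detZ p u1 = N * detZ u0 u1 := by simp only [hp, detZ]; ring
  have q3 : detZ us p = N * (- detZ u0 us) + detZ us u1 := by simp only [hp, detZ]; ring
  have q4 : detZ p ut = N * detZ u0 ut + detZ u1 ut := by simp only [hp, detZ]; ring
  have idn : detZ us ut * detZ u0 u1 = detZ u0 ut * detZ us u1 - detZ u0 us * detZ ut u1 := by
    simp only [detZ]; ring
  have r1 : 0 < detZ u0 p := by omega
  have r2 : 0 < detZ p u1 := by rw [q2]; positivity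
  have r4 : 0 < detZ p ut := by rw [q4]; nlinarith
  have r3 : 0 < detZ us p := by
    rw [q3]
    rcases hneg.eq_or_lt with e | e
    · rw [e] at idn ⊢
      have : 0 < detZ u0 ut * detZ us u1 := by nlinarith
      have := pos_of_mul_pos_right this hpos.le
      omega
    · nlinarith
  have m1 : toR2 p ∈ interior (coneOf u0 u1) := by
    rw [mem_interior_coneOf_iff _ _ d0, detR_toR2, detR_toR2]
    exact ⟨by exact_mod_cast r1, by exact_mod_cast r2⟩
  have m2 : toR2 p ∈ interior (coneOf us ut) := by
    rw [mem_interior_coneOf_iff _ _ d1, detR_toR2, detR_toR2]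
    exact ⟨by exact_mod_cast r3, by exact_mod_cast r4⟩
  have : toR2 p ∈ (∅ : Set (ℝ × ℝ)) := hD ▸ ⟨m1, m2⟩
  exact this

lemma fan_mono {d : ℕ} {v : ZMod d → ℤ × ℤ} (h : IsCompleteFanData d v) (j : ZMod d) (s t : ℕ)
    (hs1 : 1 ≤ s) (hst : s ≤ t) (ht : t < d) (hneg : detZ (v j) (v (j + s)) ≤ 0) :
    detZ (v j) (v (j + t)) ≤ 0 := by
  induction t, hst using Nat.le_induction with
  | base => exact hneg
  | succ n hn ih => exact fan_step h j n (by omega) ht (ih (by omega))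

/-- `E = D (1 - ℓ)` for the edge `i` and the point `p`. -/
def edgeE {d : ℕ} (v : ZMod d → ℤ × ℤ) (p : ℤ × ℤ) (i : ZMod d) : ℤ :=
  detZ (v i) (v (i + 1)) + detZ (v (i + 1)) p + detZ p (v i)

lemma edgeE_rel {d : ℕ} (v : ZMod d → ℤ × ℤ) (p : ℤ × ℤ) (i : ZMod d) :
    detZ (v i) (v (i + 1)) * edgeE v p (i - 1)
      = detZ (v (i - 1)) (v i) * edgeE v p i + fanF d v i * detZ (v i) p := by
  unfold edgeE fanF
  rw [sub_add_cancel]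
  simp only [detZ]; ring

lemma edgeE_fwd {d : ℕ} {v : ZMod d → ℤ × ℤ} (h : IsLDPFanData d v) (j : ZMod d) (s : ℕ)
    (hs : ∀ m : ℕ, 1 ≤ m → m ≤ s + 1 → 0 ≤ detZ (v j) (v (j + m))) :
    1 ≤ edgeE v (v j) (j + (s + 1 : ℕ)) := by
  induction s with
  | zero =>
    have r := edgeE_rel v (v j) (j + 1)
    have d0 := h.1.2.2.1 j
    have d1 := h.1.2.2.1 (j + 1)
    have f1 := h.2 (j + 1)
    have e : edgeE v (v j) j = 0 := by unfold edgeE; simp only [detZ]; ring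
    rw [add_sub_cancel_right, e, detZ_anti (v (j + 1)) (v j)] at r
    have hc : j + ((0 + 1 : ℕ) : ZMod d) = j + 1 := by simp
    rw [hc]
    by_contra hE
    push Not at hE
    nlinarith [mul_pos (show 0 < fanF d v (j + 1) by omega) (show 0 < detZ (v j) (v (j + 1)) by omega)]
  | succ n ih =>
    have ih := ih (fun m h1 h2 => hs m h1 (by omega))
    have hd := hs (n + 1 + 1) (by omega) le_rfl
    have hc : j + ((n + 1 + 1 : ℕ) : ZMod d) = j + (n + 1 : ℕ) + 1 := by push_cast; ring
    rw [hc] at hd ⊢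
    set i := j + ((n + 1 : ℕ) : ZMod d)
    have r := edgeE_rel v (v j) (i + 1)
    have d0 := h.1.2.2.1 i
    have d1 := h.1.2.2.1 (i + 1)
    have f1 := h.2 (i + 1)
    rw [add_sub_cancel_right, detZ_anti (v (i + 1)) (v j)] at r
    by_contra hE
    push Not at hE
    nlinarith [mul_nonneg (show 0 ≤ fanF d v (i + 1) by omega) hd,
      mul_pos (show 0 < detZ (v (i + 1)) (v (i + 1 + 1)) by omega) (show 0 < edgeE v (v j) i by omega)]

lemma edgeE_bwd {d : ℕ} {v : ZMod d → ℤ × ℤ} (h : IsLDPFanData d v) (j : ZMod d) (s : ℕ)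
    (hs : ∀ m : ℕ, 1 ≤ m → m ≤ s + 1 → 0 ≤ detZ (v (j - m)) (v j)) :
    1 ≤ edgeE v (v j) (j - (s + 1 : ℕ) - 1) := by
  induction s with
  | zero =>
    have hc : j - ((0 + 1 : ℕ) : ZMod d) = j - 1 := by simp
    rw [hc]
    have r := edgeE_rel v (v j) (j - 1)
    have d0 := h.1.2.2.1 (j - 1)
    have d1 := h.1.2.2.1 (j - 1 - 1)
    have f1 := h.2 (j - 1)
    have e : edgeE v (v j) (j - 1) = 0 := by
      unfold edgeE; rw [sub_add_cancel]; simp only [detZ]; ring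
    rw [e] at r
    rw [sub_add_cancel] at r d0 d1
    by_contra hE
    push Not at hE
    nlinarith [mul_pos (show 0 < fanF d v (j - 1) by omega) (show 0 < detZ (v (j - 1)) (v j) by omega)]
  | succ n ih =>
    have ih := ih (fun m h1 h2 => hs m h1 (by omega))
    have hd := hs (n + 1 + 1) (by omega) le_rfl
    have hc : j - ((n + 1 + 1 : ℕ) : ZMod d) = j - (n + 1 : ℕ) - 1 := by push_cast; ring
    rw [hc] at hd ⊢
    set i := j - ((n + 1 : ℕ) : ZMod d) - 1
    have r := edgeE_rel v (v j) i
    have d0 := h.1.2.2.1 i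
    have d1 := h.1.2.2.1 (i - 1)
    have f1 := h.2 i
    rw [sub_add_cancel] at d1
    by_contra hE
    push Not at hE
    nlinarith [mul_nonneg (show 0 ≤ fanF d v i by omega) hd,
      mul_pos (show 0 < detZ (v (i - 1)) (v i) by omega) (show 0 < edgeE v (v j) i by omega)]

/-- Every vertex not on an edge lies strictly on the inner side of this edge. -/
lemma fan_convex {d : ℕ} {v : ZMod d → ℤ × ℤ} (h : IsLDPFanData d v) (i j : ZMod d)
    (h1 : j ≠ i) (h2 : j ≠ i + 1) :
    1 ≤ detZ (v i) (v (i + 1)) + detZ (v (i + 1)) (v j) + detZ (v j) (v i) := by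
  change 1 ≤ edgeE v (v j) i
  have hd3 := h.1.1
  have : NeZero d := ⟨by omega⟩
  obtain ⟨s, hsd, hs⟩ : ∃ s : ℕ, s < d ∧ i = j + s :=
    ⟨(i - j).val, ZMod.val_lt _, by rw [ZMod.natCast_zmod_val]; ring⟩
  have hs0 : s ≠ 0 := by
    rintro rfl
    exact h1 (by simpa using hs.symm)
  have hs1 : s + 1 ≠ d := by
    intro e
    apply h2
    have : ((s + 1 : ℕ) : ZMod d) = 0 := by rw [e]; simp
    push_cast at this
    rw [hs, add_assoc, this, add_zero]
  by_cases hc : detZ (v j) (v (j + (s + 1 : ℕ))) ≤ 0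
  · have hi : i = j - ((d - 2 - s + 1 : ℕ) : ZMod d) - 1 := by
      have : ((d - 2 - s + 1 + 1 + s : ℕ) : ZMod d) = 0 := by
        rw [show d - 2 - s + 1 + 1 + s = d by omega]; simp
      push_cast at this ⊢
      rw [hs]
      linear_combination this
    rw [hi]
    apply edgeE_bwd h
    intro m hm1 hm2
    have e : j - (m : ZMod d) = j + ((d - m : ℕ) : ZMod d) := by
      rw [Nat.cast_sub (by omega)]; simp [sub_eq_add_neg]
    rw [e, detZ_anti]
    have := fan_mono h.1 j (s + 1) (d - m) (by omega) (by omega) (by omega) hc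
    omega
  · obtain ⟨s', rfl⟩ : ∃ s', s = s' + 1 := ⟨s - 1, by omega⟩
    rw [hs]
    apply edgeE_fwd h
    intro m hm1 hm2
    by_contra hneg
    exact hc (fan_mono h.1 j m _ hm1 (by omega) (by omega) (by omega))

/-! ### Existence of a contractible ray -/

lemma detZ_expand (p q v1 v2 : ℤ × ℤ) (h : detZ v1 v2 = 1) :
    detZ p q = detZ p v2 * detZ v1 q - detZ v1 p * detZ q v2 := by
  have : detZ p q * detZ v1 v2 = detZ p v2 * detZ v1 q - detZ v1 p * detZ q v2 := by
    simp only [detZ]; ring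
  rwa [h, mul_one] at this

/-- Twice the signed area of a triangle. -/
def area3 (p q r : ℤ × ℤ) : ℤ := detZ p q + detZ q r + detZ r p

lemma vec_run3 (v0 v1 v2 v3 q r : ℤ × ℤ) (h01 : detZ v0 v1 = 1) (h12 : detZ v1 v2 = 1)
    (h23 : detZ v2 v3 = 1) (ha : detZ v0 v2 ≤ 0) (hb : detZ v1 v3 ≤ 0)
    (q1 : 1 ≤ area3 v0 v1 q) (q2 : 1 ≤ area3 v1 v2 q) (q3 : 1 ≤ area3 v2 v3 q)
    (r1 : 1 ≤ area3 v0 v1 r) (r2 : 1 ≤ area3 v1 v2 r) (r3 : 1 ≤ area3 v2 v3 r)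
    (hqr : 1 ≤ detZ q r) : False := by
  unfold area3 at *
  have e0 := fun q => detZ_expand q v0 v1 v2 h12
  have e3 := fun q => detZ_expand v3 q v1 v2 h12
  have eqr := detZ_expand q r v1 v2 h12
  have a1 := detZ_anti v1 v0
  have a2 := detZ_anti v3 v2
  have a3 := detZ_anti v2 q
  have a4 := detZ_anti q v1
  have a5 := detZ_anti v2 r
  have a6 := detZ_anti r v1
  rw [h01] at a1
  rw [h23] at a2
  rw [e0 q, a1] at q1
  rw [e0 r, a1] at r1
  rw [e3 q, a2] at q3
  rw [e3 r, a2] at r3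
  refine scal_run3 (detZ v0 v2) (detZ v1 v3) (detZ q v2) (detZ v1 q) (detZ r v2) (detZ v1 r)
    ha hb ?_ ?_ ?_ ?_ ?_ ?_ ?_
  all_goals linarith

lemma vec_pair (v0 v1 v2 w z : ℤ × ℤ) (h01 : detZ v0 v1 = 1) (h12 : detZ v1 v2 = 1)
    (ha : detZ v0 v2 ≤ 0) (hwz : detZ w z = 1)
    (w1 : 1 ≤ area3 v0 v1 w) (w2 : 1 ≤ area3 v1 v2 w)
    (s2 : 1 ≤ area3 w z v2) (s0 : 1 ≤ area3 w z v0)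
    (hsing : 2 ≤ detZ v2 w ∨ 2 ≤ detZ z v0) : False := by
  unfold area3 at *
  have e0 := fun q => detZ_expand q v0 v1 v2 h12
  have ewz := detZ_expand w z v1 v2 h12
  have a1 := detZ_anti v1 v0
  have a3 := detZ_anti v2 w
  have a4 := detZ_anti w v1
  have a5 := detZ_anti v2 z
  have a6 := detZ_anti z v1
  have a7 := detZ_anti v0 w
  rw [h01] at a1
  rw [e0 w, a1] at w1 a7
  rw [e0 z, a1] at s0 hsing
  refine scal_pair (detZ v0 v2) (detZ w v2) (detZ v1 w) (detZ z v2) (detZ v1 z)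
    ha ?_ ?_ ?_ ?_ ?_ ?_
  case refine_6 => rcases hsing with h | h
                   · left; linarith
                   · right; linarith
  all_goals linarith

lemma vec_three (C D A A' B E : ℤ × ℤ) (hC : detZ C D = 1) (hA : detZ A A' = 1)
    (hB : detZ B E = 1) (hDA : 2 ≤ detZ D A) (hAB : 2 ≤ detZ A' B)
    (aD : 1 ≤ area3 A A' D) (aB : 1 ≤ area3 A A' B)
    (bA : 1 ≤ area3 B E A) (bA' : 1 ≤ area3 B E A')
    (cA : 1 ≤ area3 C D A) (cA' : 1 ≤ area3 C D A') (cB : 1 ≤ area3 C D B) : False := by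
  unfold area3 at *
  have eBE := detZ_expand B E A A' hA
  have eCD := detZ_expand C D A A' hA
  have eDB := detZ_expand D B A A' hA
  have eBC := detZ_expand B C A A' hA
  have a1 := detZ_anti A' D
  have a2 := detZ_anti A' B
  have a3 := detZ_anti D A
  have a4 := detZ_anti B A
  have a5 := detZ_anti A' C
  have a6 := detZ_anti E A
  have a7 := detZ_anti A' E
  have a8 := detZ_anti C A
  generalize detZ B A' = x at *
  generalize detZ A B = y at *
  generalize detZ E A' = x' at *
  generalize detZ A E = y' at *
  generalize detZ C A' = cx at *
  generalize detZ A C = cy at *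
  generalize detZ D A' = dx at *
  generalize detZ A D = dy at *
  have k1 : 0 ≤ (x' - x) + (y' - y) :=
    scal_sep x y (x' - x) (y' - y) (by linarith) (by linarith) (by linarith) (by linarith)
  have k2 : 0 ≤ -(dy - cy) + -(dx - cx) :=
    scal_sep dy dx (-(dy - cy)) (-(dx - cx)) (by linarith) (by linarith) (by linarith) (by linarith)
  refine scal_three x y (x' - x) (y' - y) (dx - cx) (dy - cy) (by linarith) (by linarith) k1
    (by linarith) (by linarith) (by linarith) (by linarith) (by linarith) (by linarith) ?_
  by_contra hne
  push Not at hne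
  have : dx = cx := by linarith
  have : dy = cy := by linarith
  subst dx dy
  linarith

lemma add_cast_ne {d : ℕ} (b : ZMod d) {m n : ℕ} (h1 : m < n) (h2 : n < d) :
    b + (m : ZMod d) ≠ b + (n : ZMod d) := by
  intro e
  have e := add_left_cancel e
  rw [ZMod.natCast_eq_natCast_iff'] at e
  rw [Nat.mod_eq_of_lt h2, Nat.mod_eq_of_lt (h1.trans h2)] at e
  omega

lemma four_singular {d : ℕ} {P : ZMod d → Prop} (hd : 6 ≤ d) (hs : {i | P i}.ncard = 3)
    (b : ZMod d) (m1 m2 m3 m4 : ℕ) (h12 : m1 < m2) (h23 : m2 < m3) (h34 : m3 < m4) (h4 : m4 < d)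
    (p1 : P (b + m1)) (p2 : P (b + m2)) (p3 : P (b + m3)) (p4 : P (b + m4)) : False := by
  have : NeZero d := ⟨by omega⟩
  have hcard : ({b + (m1 : ZMod d), b + (m2 : ZMod d), b + (m3 : ZMod d), b + (m4 : ZMod d)} :
      Finset (ZMod d)).card = 4 := by
    rw [Finset.card_insert_of_notMem, Finset.card_insert_of_notMem, Finset.card_insert_of_notMem,
      Finset.card_singleton]
    · simpa using add_cast_ne b h34 h4
    · have := add_cast_ne b h23 (by omega)
      have := add_cast_ne b (h23.trans h34) h4
      simp_all
    · have := add_cast_ne b h12 (by omega)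
      have := add_cast_ne b (h12.trans h23) (by omega)
      have := add_cast_ne b (h12.trans (h23.trans h34)) h4
      simp_all
  have hsub : (({b + (m1 : ZMod d), b + (m2 : ZMod d), b + (m3 : ZMod d), b + (m4 : ZMod d)} :
      Finset (ZMod d)) : Set (ZMod d)) ⊆ {i | P i} := by
    intro i hi
    simp only [Finset.coe_insert, Finset.coe_singleton, Set.mem_insert_iff,
      Set.mem_singleton_iff] at hi
    rcases hi with rfl | rfl | rfl | rfl <;> assumption
  have := Set.ncard_le_ncard hsub (Set.toFinite _)
  rw [Set.ncard_coe_finset, hcard, hs] at this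
  omega

/-- The combinatorial part: a cyclic word with exactly three singular letters. -/
lemma cyclic_word {d : ℕ} {P : ZMod d → Prop} (hd : 6 ≤ d) (hs : {i | P i}.ncard = 3)
    (c1 : ∀ b, ¬ P b → ¬ P (b + 1) → ¬ P (b + 2) → False)
    (c2 : ∀ b, ¬ P b → ¬ P (b + 1) → P (b + 2) → ¬ P (b + 3) → False)
    (c3 : ∀ b, ¬ P b → P (b + 1) → ¬ P (b + 2) → ¬ P (b + 3) → False)
    (c4 : ∀ b, ¬ P b → P (b + 1) → ¬ P (b + 2) → P (b + 3) → ¬ P (b + 4) → False) : False := by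
  have four := fun b m1 m2 m3 m4 => four_singular hd hs b m1 m2 m3 m4
  by_cases hA : ∃ b, ¬ P (b + 2) ∧ ¬ P (b + 3)
  · obtain ⟨b, n2, n3⟩ := hA
    have s4 : P (b + 4) := by
      by_contra n4
      exact c1 (b + 2) n2 (by ring_nf at *; exact n3) (by ring_nf at *; exact n4)
    have s1 : P (b + 1) := by
      by_contra n1
      exact c1 (b + 1) n1 (by ring_nf at *; exact n2) (by ring_nf at *; exact n3)
    have s5 : P (b + 5) := by
      by_contra n5
      exact c2 (b + 2) n2 (by ring_nf at *; exact n3) (by ring_nf at *; exact s4)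
        (by ring_nf at *; exact n5)
    have s0 : P b := by
      by_contra n0
      exact c3 b n0 s1 n2 n3
    exact four b 0 1 4 5 (by omega) (by omega) (by omega) (by omega) (by simpa using s0)
      (by simpa using s1) (by simpa using s4) (by simpa using s5)
  · push Not at hA
    have hA' : ∀ b, ¬ P b → P (b + 1) := by
      intro b hb
      have := hA (b - 2)
      ring_nf at this
      rw [add_comm]
      exact this hb
    obtain ⟨j, hj⟩ : ∃ j, ¬ P (j + 3) := by
      by_contra hall
      push Not at hall
      have hall' : ∀ j, P j := fun j => by simpa using hall (j - 3)
      exact four 0 0 1 2 3 (by omega) (by omega) (by omega) (by omega) (hall' _) (hall' _)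
        (hall' _) (hall' _)
    have s4 : P (j + 4) := by have := hA' _ hj; ring_nf at this ⊢; exact this
    have s2 : P (j + 2) := by
      by_contra n2
      apply hj
      have := hA' _ n2; ring_nf at this ⊢; exact this
    by_cases n5 : P (j + 5)
    · by_cases n1 : P (j + 1)
      · exact four j 1 2 4 5 (by omega) (by omega) (by omega) (by omega) (by simpa using n1)
          (by simpa using s2) (by simpa using s4) (by simpa using n5)
      · have s0 : P j := by
          by_contra n0
          exact n1 (hA' _ n0)
        exact four j 0 2 4 5 (by omega) (by omega) (by omega) (by omega) (by simpa using s0)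
          (by simpa using s2) (by simpa using s4) (by simpa using n5)
    · have s6 : P (j + 6) := by have := hA' _ n5; ring_nf at this ⊢; exact this
      by_cases n1 : P (j + 1)
      · refine four (j + 1) 0 1 3 5 (by omega) (by omega) (by omega) (by omega) ?_ ?_ ?_ ?_
        all_goals push_cast; ring_nf at *; assumption
      · refine c4 (j + 1) n1 ?_ ?_ ?_ ?_
        all_goals ring_nf at *; assumption

lemma exists_contractible {d : ℕ} {v : ZMod d → ℤ × ℤ} (hd : 6 ≤ d) (h : IsLDPFanData d v)
    (hs : numSingular d v = 3) :
    ∃ k : ZMod d, v k = v (k - 1) + v (k + 1) ∧ detZ (v (k - 1)) (v k) = 1 ∧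
      detZ (v k) (v (k + 1)) = 1 := by
  by_contra hno
  push Not at hno
  have hN : ∀ i, ¬ (2 ≤ detZ (v i) (v (i + 1))) → detZ (v i) (v (i + 1)) = 1 := by
    intro i hi
    have := h.1.2.2.1 i
    omega
  have step : ∀ (b : ZMod d) (n : ℕ), b + ((n + 1 : ℕ) : ZMod d) = b + n + 1 := by
    intro b n; push_cast; ring
  have cvx : ∀ (b : ZMod d) (n m : ℕ), n + 1 < d → m < d → m ≠ n → m ≠ n + 1 →
      1 ≤ area3 (v (b + n)) (v (b + (n + 1 : ℕ))) (v (b + m)) := by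
    intro b n m hn hm h1 h2
    have := fan_convex h (b + n) (b + m) ?_ ?_
    · unfold area3; rw [step]; exact this
    · rcases lt_or_gt_of_ne h1 with h | h
      · exact add_cast_ne b h (by omega)
      · exact (add_cast_ne b h hm).symm
    · rw [← step]
      rcases lt_or_gt_of_ne h2 with h | h
      · exact add_cast_ne b h hn
      · exact (add_cast_ne b h hm).symm
  have ngeom : ∀ a b c : ℤ × ℤ, detZ a b = 1 → detZ b c = 1 → detZ a c = 1 → b = a + c := by
    intro a b c h1 h2 h3
    have i1 : detZ a c * b.1 = detZ b c * a.1 + detZ a b * c.1 := by simp only [detZ]; ring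
    have i2 : detZ a c * b.2 = detZ b c * a.2 + detZ a b * c.2 := by simp only [detZ]; ring
    rw [h1, h2, h3] at i1 i2
    ext
    · simp; linarith
    · simp; linarith
  have neg : ∀ (b : ZMod d) (n : ℕ), detZ (v (b + n)) (v (b + (n + 1 : ℕ))) = 1 →
      detZ (v (b + (n + 1 : ℕ))) (v (b + (n + 2 : ℕ))) = 1 →
      detZ (v (b + n)) (v (b + (n + 2 : ℕ))) ≤ 0 := by
    intro b n h1 h2
    have e1 : b + ((n + 1 : ℕ) : ZMod d) - 1 = b + n := by push_cast; ring
    have e2 : b + ((n + 1 : ℕ) : ZMod d) + 1 = b + (n + 2 : ℕ) := by push_cast; ring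
    have hf := h.2 (b + (n + 1 : ℕ))
    have hn := hno (b + (n + 1 : ℕ))
    unfold fanF at hf
    rw [e1, e2] at hf hn
    rw [h1, h2, detZ_anti] at hf
    by_contra hpos
    exact hn (ngeom _ _ _ h1 h2 (by omega)) h1 h2
  have ed : ∀ (b : ZMod d) (n : ℕ), ¬ (2 ≤ detZ (v (b + n)) (v (b + n + 1))) →
      detZ (v (b + n)) (v (b + (n + 1 : ℕ))) = 1 := by
    intro b n hn
    rw [step]
    exact hN _ hn
  refine cyclic_word (P := fun i => 2 ≤ detZ (v i) (v (i + 1))) hd hs ?_ ?_ ?_ ?_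
  · intro b n0 n1 n2
    have n0 := ed b 0 (by simpa using n0)
    have n1 := ed b 1 (by simpa using n1)
    have n2 := ed b 2 (by simpa using n2)
    refine vec_run3 _ _ _ _ (v (b + (4 : ℕ))) (v (b + (5 : ℕ))) n0 n1 n2 (neg b 0 n0 n1)
      (neg b 1 n1 n2) ?_ ?_ ?_ ?_ ?_ ?_ ?_
    · exact cvx b 0 4 (by omega) (by omega) (by omega) (by omega)
    · exact cvx b 1 4 (by omega) (by omega) (by omega) (by omega)
    · exact cvx b 2 4 (by omega) (by omega) (by omega) (by omega)
    · exact cvx b 0 5 (by omega) (by omega) (by omega) (by omega)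
    · exact cvx b 1 5 (by omega) (by omega) (by omega) (by omega)
    · exact cvx b 2 5 (by omega) (by omega) (by omega) (by omega)
    · have := h.1.2.2.1 (b + (4 : ℕ))
      rwa [← step] at this
  · intro b n0 n1 s2 n3
    have n0 := ed b 0 (by simpa using n0)
    have n1 := ed b 1 (by simpa using n1)
    have n3 := ed b 3 (by simpa using n3)
    have s2 : 2 ≤ detZ (v (b + (2 : ℕ))) (v (b + (2 + 1 : ℕ))) := by
      rw [step b 2]; simpa using s2
    refine vec_pair _ _ _ _ _ n0 n1 (neg b 0 n0 n1) n3 ?_ ?_ ?_ ?_ (Or.inl s2)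
    · exact cvx b 0 3 (by omega) (by omega) (by omega) (by omega)
    · exact cvx b 1 3 (by omega) (by omega) (by omega) (by omega)
    · exact cvx b 3 2 (by omega) (by omega) (by omega) (by omega)
    · exact cvx b 3 0 (by omega) (by omega) (by omega) (by omega)
  · intro b n0 s1 n2 n3
    have n0 := ed b 0 (by simpa using n0)
    have n2 := ed b 2 (by simpa using n2)
    have n3 := ed b 3 (by simpa using n3)
    have s1 : 2 ≤ detZ (v (b + (1 : ℕ))) (v (b + (1 + 1 : ℕ))) := by
      rw [step b 1]; simpa using s1
    refine vec_pair _ _ _ _ _ n2 n3 (neg b 2 n2 n3) n0 ?_ ?_ ?_ ?_ (Or.inr s1)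
    · exact cvx b 2 0 (by omega) (by omega) (by omega) (by omega)
    · exact cvx b 3 0 (by omega) (by omega) (by omega) (by omega)
    · exact cvx b 0 4 (by omega) (by omega) (by omega) (by omega)
    · exact cvx b 0 2 (by omega) (by omega) (by omega) (by omega)
  · intro b n0 s1 n2 s3 n4
    have n0 := ed b 0 (by simpa using n0)
    have n2 := ed b 2 (by simpa using n2)
    have n4 := ed b 4 (by simpa using n4)
    have s1 : 2 ≤ detZ (v (b + (1 : ℕ))) (v (b + (1 + 1 : ℕ))) := by
      rw [step b 1]; simpa using s1
    have s3 : 2 ≤ detZ (v (b + (3 : ℕ))) (v (b + (3 + 1 : ℕ))) := by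
      rw [step b 3]; simpa using s3
    refine vec_three _ _ _ _ _ _ n0 n2 n4 s1 s3 ?_ ?_ ?_ ?_ ?_ ?_ ?_
    · exact cvx b 2 1 (by omega) (by omega) (by omega) (by omega)
    · exact cvx b 2 4 (by omega) (by omega) (by omega) (by omega)
    · exact cvx b 4 2 (by omega) (by omega) (by omega) (by omega)
    · exact cvx b 4 3 (by omega) (by omega) (by omega) (by omega)
    · exact cvx b 0 2 (by omega) (by omega) (by omega) (by omega)
    · exact cvx b 0 3 (by omega) (by omega) (by omega) (by omega)
    · exact cvx b 0 4 (by omega) (by omega) (by omega) (by omega)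

/-! ### Blowing down -/

lemma blowdown {n : ℕ} (hn : 4 ≤ n) {v : ZMod (n + 1) → ℤ × ℤ} (h : IsLDPFanData (n + 1) v)
    (k : ZMod (n + 1)) (hk : v k = v (k - 1) + v (k + 1)) (hk1 : detZ (v (k - 1)) (v k) = 1)
    (hk2 : detZ (v k) (v (k + 1)) = 1) (w : ZMod n → ℤ × ℤ)
    (hw : w = fun i => v (k + 1 + (i.val : ZMod (n + 1)))) :
    IsLDPFanData n w ∧ numSingular n w = numSingular (n + 1) v := by
  have : NeZero n := ⟨by omega⟩
  obtain ⟨φ, hφ⟩ : ∃ φ : ZMod n → ZMod (n + 1), φ = fun i => k + 1 + (i.val : ZMod (n + 1)) :=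
    ⟨_, rfl⟩
  have hwφ : ∀ i, w i = v (φ i) := by intro i; rw [hw, hφ]
  have hlast : ((n : ℕ) : ZMod (n + 1)) = -1 := by
    have : ((n + 1 : ℕ) : ZMod (n + 1)) = 0 := ZMod.natCast_self _
    push_cast at this
    linear_combination this
  have hinj : Function.Injective φ := by
    intro i j hij
    have hi := ZMod.val_lt i
    have hj := ZMod.val_lt j
    rw [hφ] at hij
    rcases lt_trichotomy i.val j.val with h | h | h
    · exact absurd hij (add_cast_ne _ h (by omega))
    · exact ZMod.val_injective n h
    · exact absurd hij (add_cast_ne _ h (by omega)).symm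
  have hkm : k = k + 1 + ((n : ℕ) : ZMod (n + 1)) := by rw [hlast]; ring
  have hkm1 : k - 1 = k + 1 + ((n - 1 : ℕ) : ZMod (n + 1)) := by
    rw [Nat.cast_sub (by omega), hlast]; push_cast; ring
  have hnek : ∀ i, φ i ≠ k := by
    intro i hi
    have hlt := ZMod.val_lt i
    rw [hφ] at hi
    exact add_cast_ne (k + 1) hlt (by omega) (hi.trans hkm)
  have hsurj : ∀ j, j ≠ k → ∃ i, φ i = j := by
    intro j hj
    have hlt := ZMod.val_lt (j - (k + 1))
    have hv : (((j - (k + 1)).val : ℕ) : ZMod (n + 1)) = j - (k + 1) := ZMod.natCast_zmod_val _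
    have hne : (j - (k + 1)).val ≠ n := by
      intro e
      rw [e, hlast] at hv
      apply hj
      linear_combination -hv
    refine ⟨((j - (k + 1)).val : ℕ), ?_⟩
    rw [hφ]
    simp only []
    rw [ZMod.val_natCast, Nat.mod_eq_of_lt (by omega), hv]
    ring
  have hsucc : ∀ i, (φ i = k - 1 ∧ φ (i + 1) = k + 1) ∨ (φ i ≠ k - 1 ∧ φ (i + 1) = φ i + 1) := by
    intro i
    have hlt := ZMod.val_lt i
    have hone : (1 : ZMod n).val = 1 := by
      have := ZMod.val_natCast n 1
      rw [Nat.mod_eq_of_lt (by omega)] at this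
      simpa using this
    by_cases hi : i.val = n - 1
    · left
      have : (i + 1).val = 0 := by
        rw [ZMod.val_add, hone, hi, show n - 1 + 1 = n by omega, Nat.mod_self]
      rw [hφ]
      simp only []
      rw [hi, this]
      exact ⟨hkm1.symm, by simp⟩
    · right
      have : (i + 1).val = i.val + 1 := by
        rw [ZMod.val_add, hone, Nat.mod_eq_of_lt (by omega)]
      constructor
      · intro e
        have := hsurj (k - 1)
        rw [hφ] at e
        exact add_cast_ne (k + 1) (show i.val < n - 1 by omega) (by omega) (e.trans hkm1)
      · rw [hφ]
        simp only []
        rw [this]; push_cast; ring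
  clear hφ hw
  obtain ⟨⟨-, hprim, hdet, hcov, hdis⟩, hf⟩ := h
  have hab : detZ (v (k - 1)) (v (k + 1)) = 1 := by
    rw [hk] at hk1
    simp only [detZ, Prod.fst_add, Prod.snd_add] at hk1 ⊢
    linarith
  have hone : (1 : ZMod (n + 1)) ≠ 0 := by
    simpa using natCast_ne_zero_of_lt (d := n + 1) (n := 1) (by omega) (by omega)
  have htwo : (2 : ZMod (n + 1)) ≠ 0 := by
    simpa using natCast_ne_zero_of_lt (d := n + 1) (n := 2) (by omega) (by omega)
  have hwdet : ∀ i, 1 ≤ detZ (w i) (w (i + 1)) := by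
    intro i
    rw [hwφ, hwφ]
    rcases hsucc i with ⟨h1, h2⟩ | ⟨h1, h2⟩
    · rw [h1, h2, hab]
    · rw [h2]; exact hdet _
  have pert : ∀ (i : ZMod n) (U : Set (ℝ × ℝ)), IsOpen U →
      (U ∩ interior (coneOf (w i) (w (i + 1)))).Nonempty →
      ∃ j, (j = φ i ∨ (φ i = k - 1 ∧ j = k)) ∧
        (U ∩ interior (coneOf (v j) (v (j + 1)))).Nonempty := by
    rintro i U hU ⟨x, hxU, hx⟩
    rcases hsucc i with ⟨h1, h2⟩ | ⟨h1, h2⟩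
    · rw [hwφ, hwφ, h1, h2] at hx
      have dk1 : 1 ≤ detZ (v (k - 1)) (v k) := hk1.ge
      have dk2 : 1 ≤ detZ (v k) (v (k + 1)) := hk2.ge
      obtain ⟨e, he, heU, hei⟩ := exists_small _ (hU.inter isOpen_interior) x (toR2 (v (k + 1)))
        ⟨hxU, hx⟩
      rw [mem_interior_coneOf_iff _ _ hab.ge] at hx hei
      rcases lt_or_ge (detR (toR2 (v k)) x) 0 with hneg | hnn
      · refine ⟨k - 1, Or.inl h1.symm, x, hxU, ?_⟩
        rw [sub_add_cancel, mem_interior_coneOf_iff _ _ dk1]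
        refine ⟨hx.1, ?_⟩
        have : detR x (toR2 (v k)) = - detR (toR2 (v k)) x := by unfold detR; ring
        rw [this]; linarith
      · refine ⟨k, Or.inr ⟨h1, rfl⟩, _, heU, ?_⟩
        rw [mem_interior_coneOf_iff _ _ dk2]
        refine ⟨?_, hei.2⟩
        have e1 : detR (toR2 (v k)) (x + e • toR2 (v (k + 1)))
            = detR (toR2 (v k)) x + e * detR (toR2 (v k)) (toR2 (v (k + 1))) := by
          simp [detR]; ring
        rw [e1, detR_toR2, hk2]
        push_cast
        linarith
    · refine ⟨φ i, Or.inl rfl, x, hxU, ?_⟩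
      rw [hwφ, hwφ, h2] at hx
      exact hx
  refine ⟨⟨⟨by omega, ?_, hwdet, ?_, ?_⟩, ?_⟩, ?_⟩
  · intro i; rw [hwφ]; exact hprim _
  · rw [Set.eq_univ_iff_forall]
    intro x
    have hx : x ∈ ⋃ i, coneOf (v i) (v (i + 1)) := hcov ▸ Set.mem_univ x
    rw [Set.mem_iUnion] at hx ⊢
    obtain ⟨j, hj⟩ := hx
    have hjk : j = k ∨ j = k - 1 ∨ (j ≠ k ∧ j ≠ k - 1) := by tauto
    have hvk : toR2 (v k) = toR2 (v (k - 1)) + toR2 (v (k + 1)) := by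
      rw [hk]; ext <;> simp [toR2]
    obtain ⟨i0, hi0⟩ := hsurj (k - 1) (by
      intro e; apply hone; linear_combination -e)
    have hi0' : φ (i0 + 1) = k + 1 := by
      rcases hsucc i0 with ⟨_, h2⟩ | ⟨h1, _⟩
      · exact h2
      · exact absurd hi0 h1
    rcases hjk with rfl | rfl | ⟨h1, h2⟩
    · refine ⟨i0, ?_⟩
      rw [hwφ, hwφ, hi0, hi0']
      obtain ⟨a, b, ha, hb, rfl⟩ := hj
      exact ⟨a, a + b, ha, by positivity, by rw [hvk]; module⟩
    · refine ⟨i0, ?_⟩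
      rw [hwφ, hwφ, hi0, hi0']
      obtain ⟨a, b, ha, hb, rfl⟩ := hj
      refine ⟨a + b, b, by positivity, hb, ?_⟩
      rw [sub_add_cancel, hvk]; module
    · obtain ⟨i, rfl⟩ := hsurj j h1
      refine ⟨i, ?_⟩
      rw [hwφ, hwφ]
      rcases hsucc i with ⟨h3, _⟩ | ⟨_, h3⟩
      · exact absurd h3 h2
      · rw [h3]; exact hj
  · intro i i' hii
    by_contra hne
    rw [← Ne, ← Set.nonempty_iff_ne_empty] at hne
    obtain ⟨j', hj', hne'⟩ := pert i' _ isOpen_interior hne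
    rw [Set.inter_comm] at hne'
    obtain ⟨j, hj, hne''⟩ := pert i _ isOpen_interior hne'
    have hjj : j' ≠ j := by
      rintro rfl
      rcases hj with rfl | ⟨e1, rfl⟩ <;> rcases hj' with e | ⟨e2, e3⟩
      · exact hii (hinj e)
      · exact hnek _ e3
      · exact hnek _ e.symm
      · exact hii (hinj (e1.trans e2.symm))
    rw [hdis j' j hjj] at hne''
    exact Set.not_nonempty_empty hne''
  · intro i
    have hgen : ∀ i : ZMod n, 1 ≤ area3 (w i) (w (i + 1)) (w (i + 1 + 1)) := by
      intro i
      rw [hwφ, hwφ, hwφ]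
      have hfk : ∀ j, 1 ≤ area3 (v (j - 1)) (v j) (v (j + 1)) := hf
      rcases hsucc i with ⟨h1, h2⟩ | ⟨h1, h2⟩
      · rcases hsucc (i + 1) with ⟨h3, h4⟩ | ⟨h3, h4⟩
        · exfalso
          rw [h2] at h3
          apply htwo; linear_combination h3
        · rw [h4, h1, h2]
          have f1 := hfk (k + 1)
          rw [add_sub_cancel_right, hk] at f1
          have d1 := hdet (k + 1)
          rw [hk] at hk2
          unfold area3 at f1 ⊢
          simp only [detZ, Prod.fst_add, Prod.snd_add] at *
          linarith
      · rcases hsucc (i + 1) with ⟨h3, h4⟩ | ⟨h3, h4⟩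
        · rw [h4, h3]
          have e : φ i = k - 1 - 1 := by rw [← h3, h2]; ring
          rw [e]
          have f1 := hfk (k - 1)
          rw [sub_add_cancel, hk] at f1
          have d1 := hdet (k - 1 - 1)
          rw [sub_add_cancel] at d1
          rw [hk] at hk1
          unfold area3 at f1 ⊢
          simp only [detZ, Prod.fst_add, Prod.snd_add] at *
          linarith
        · rw [h4, h2]
          have := hfk (φ i + 1)
          rwa [add_sub_cancel_right] at this
    have := hgen (i - 1)
    rw [sub_add_cancel] at this
    exact this
  · unfold numSingular
    rw [← Set.ncard_image_of_injective _ hinj]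
    congr 1
    ext j
    simp only [Set.mem_image, Set.mem_ofPred_eq]
    constructor
    · rintro ⟨i, hi, rfl⟩
      rw [hwφ, hwφ] at hi
      rcases hsucc i with ⟨h1, h2⟩ | ⟨h1, h2⟩
      · rw [h1, h2, hab] at hi; omega
      · rwa [h2] at hi
    · intro hj
      have hjk : j ≠ k := by
        rintro rfl
        omega
      obtain ⟨i, rfl⟩ := hsurj j hjk
      refine ⟨i, ?_, rfl⟩
      rw [hwφ, hwφ]
      rcases hsucc i with ⟨h1, h2⟩ | ⟨h1, h2⟩
      · rw [h1, sub_add_cancel, hk1] at hj; omega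
      · rwa [h2]

/-- LDP fan data of length `d ≥ 5` with exactly three singular cones blows down,
through LDP fan data with exactly three singular cones, to data of length 5. -/
theorem three_singular_blowdown_chain (d : ℕ) (v : ZMod d → ℤ × ℤ)
    (hd : 5 ≤ d) (h : IsLDPFanData d v) (hs : numSingular d v = 3) :
    ∃ V : (m : ℕ) → (ZMod m → ℤ × ℤ),
      V d = v ∧
      (∀ m, 5 ≤ m → m ≤ d → IsLDPFanData m (V m) ∧ numSingular m (V m) = 3) ∧
      (∀ m, 6 ≤ m → m ≤ d → ∃ k : ZMod m,
        V m k = V m (k - 1) + V m (k + 1) ∧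
        detZ (V m (k - 1)) (V m k) = 1 ∧
        detZ (V m k) (V m (k + 1)) = 1 ∧
        V (m - 1) = deleteAt (V m) k) := by
  induction d, hd using Nat.le_induction with
  | base =>
    refine ⟨Function.update (fun _ _ => 0) 5 v, by simp, ?_, ?_⟩
    · intro m h1 h2
      obtain rfl : m = 5 := by omega
      simpa using ⟨h, hs⟩
    · intro m h1 h2
      omega
  | succ n hn ih =>
    obtain ⟨k, hk, hk1, hk2⟩ := exists_contractible (by omega) h hs
    have hb := blowdown (by omega) h k hk hk1 hk2 (deleteAt v k) rfl
    obtain ⟨V, hV, hV1, hV2⟩ := ih (deleteAt v k) hb.1 (hb.2.trans hs)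
    refine ⟨Function.update V (n + 1) v, by simp, ?_, ?_⟩
    · intro m h1 h2
      by_cases e : m = n + 1
      · subst e
        simpa using ⟨h, hs⟩
      · rw [Function.update_of_ne e]
        exact hV1 m h1 (by omega)
    · intro m h1 h2
      by_cases e : m = n + 1
      · subst e
        rw [Function.update_self, Function.update_of_ne (by omega)]
        exact ⟨k, hk, hk1, hk2, hV⟩
      · rw [Function.update_of_ne e, Function.update_of_ne (by omega)]
        exact hV2 m h1 (by omega)
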